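/- arXiv:2603.29155 — 2 statements merged into one kernel-verified Lean document; each statement's English description precedes it below -/
import Mathlib

section
/- Let M be a monoid and let ρ, η : M → GL(2,ℝ) be monoid homomorphisms such that det ρ(γ) ∈ {1,−1} and det η(γ) ∈ {1,−1} for every γ ∈ M, and such that both ρ and η are irreducible. If Tr(ρ(γ)) = Tr(η(γ)) for all γ ∈ M, then there exists C ∈ GL(2,ℝ) with det C ∈ {1,−1} such that C ρ(γ) C⁻¹ = η(γ) for all γ ∈ M. -/
/-- Abbreviation for real two-by-two matrices. -/
abbrev Mat2 := Matrix (Fin 2) (Fin 2) ℝ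

lemma sq_zero_of_traces (W : Mat2) (h1 : W.trace = 0) (h2 : (W * W).trace = 0) : W * W = 0 := by
  rw [Matrix.trace_fin_two] at h1 h2
  simp only [Matrix.mul_apply, Fin.sum_univ_two] at h2
  have hd : W 1 1 = - W 0 0 := by linarith
  rw [hd] at h2
  ext i j
  fin_cases i <;> fin_cases j <;> simp [Matrix.mul_apply, Fin.sum_univ_two, hd] <;> nlinarith

lemma snd_zero (A : Submodule ℝ (Mat2 × Mat2))
    (hmul : ∀ a ∈ A, ∀ b ∈ A, a * b ∈ A)
    (htr : ∀ a ∈ A, a.1.trace = a.2.trace)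
    (hs : ∀ w : Fin 2 → ℝ, w ≠ 0 → ∀ e, ∃ a ∈ A, a.2.mulVec w = e)
    (a : Mat2 × Mat2) (ha : a ∈ A) (h0 : a.1 = 0) : a.2 = 0 := by
  by_contra hne
  obtain ⟨u, hu⟩ : ∃ u, a.2.mulVec u ≠ 0 := by
    by_contra! h
    apply hne
    apply Matrix.mulVec_injective
    ext1 u
    simp [h u]
  obtain ⟨z, hz, hzu⟩ := hs _ hu u
  have hW := hmul _ ha _ hz
  have h1 := htr _ hW
  have h2 := htr _ (hmul _ hW _ hW)
  simp only [Prod.fst_mul, Prod.snd_mul, h0, zero_mul, Matrix.trace_zero] at h1 h2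
  have h3 := sq_zero_of_traces _ h1.symm h2.symm
  have h4 : (a.2 * z.2).mulVec (a.2.mulVec u) = a.2.mulVec u := by
    rw [← Matrix.mulVec_mulVec, hzu]
  have h5 : (a.2 * z.2 * (a.2 * z.2)).mulVec (a.2.mulVec u) = a.2.mulVec u := by
    rw [← Matrix.mulVec_mulVec, h4, h4]
  rw [h3, Matrix.zero_mulVec] at h5
  exact hu h5.symm

lemma fst_zero (A : Submodule ℝ (Mat2 × Mat2))
    (hmul : ∀ a ∈ A, ∀ b ∈ A, a * b ∈ A)
    (htr : ∀ a ∈ A, a.1.trace = a.2.trace)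
    (hs : ∀ w : Fin 2 → ℝ, w ≠ 0 → ∀ e, ∃ a ∈ A, a.1.mulVec w = e)
    (a : Mat2 × Mat2) (ha : a ∈ A) (h0 : a.2 = 0) : a.1 = 0 := by
  by_contra hne
  obtain ⟨u, hu⟩ : ∃ u, a.1.mulVec u ≠ 0 := by
    by_contra! h
    apply hne
    apply Matrix.mulVec_injective
    ext1 u
    simp [h u]
  obtain ⟨z, hz, hzu⟩ := hs _ hu u
  have hW := hmul _ ha _ hz
  have h1 := htr _ hW
  have h2 := htr _ (hmul _ hW _ hW)
  simp only [Prod.fst_mul, Prod.snd_mul, h0, zero_mul, Matrix.trace_zero] at h1 h2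
  have h3 := sq_zero_of_traces _ h1 h2
  have h4 : (a.1 * z.1).mulVec (a.1.mulVec u) = a.1.mulVec u := by
    rw [← Matrix.mulVec_mulVec, hzu]
  have h5 : (a.1 * z.1 * (a.1 * z.1)).mulVec (a.1.mulVec u) = a.1.mulVec u := by
    rw [← Matrix.mulVec_mulVec, h4, h4]
  rw [h3, Matrix.zero_mulVec] at h5
  exact hu h5.symm

/-- If `X` is singular, and `Z` kills one nonzero vector of its range, then `Z * X = 0`. -/
lemma mul_zero_of_singular (X Z : Mat2) (hX : X.det = 0) (u : Fin 2 → ℝ)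
    (hu : X.mulVec u ≠ 0) (hZ : Z.mulVec (X.mulVec u) = 0) : Z * X = 0 := by
  obtain ⟨k, hk, hXk⟩ := Matrix.exists_mulVec_eq_zero_iff.mpr hX
  have hZ' : (Z * X).mulVec u = 0 := by rw [← Matrix.mulVec_mulVec, hZ]
  have hk' : (Z * X).mulVec k = 0 := by rw [← Matrix.mulVec_mulVec, hXk, Matrix.mulVec_zero]
  have hli : LinearIndependent ℝ ![k, u] := by
    rw [LinearIndependent.pair_iff' hk]
    rintro c rfl
    apply hu
    rw [Matrix.mulVec_smul, hXk, smul_zero]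
  have hsp := hli.span_eq_top_of_card_eq_finrank' (by simp)
  have : Matrix.mulVecLin (Z * X) = 0 := by
    apply LinearMap.ext_on_range hsp
    intro i
    fin_cases i
    · exact hk'
    · exact hZ'
  apply Matrix.mulVec_injective
  ext1 x
  have h := LinearMap.congr_fun this x
  rw [Matrix.mulVecLin_apply, LinearMap.zero_apply] at h
  rw [h, Matrix.zero_mulVec]

lemma exists_pair (A : Submodule ℝ (Mat2 × Mat2))
    (hmul : ∀ a ∈ A, ∀ b ∈ A, a * b ∈ A)
    (htr : ∀ a ∈ A, a.1.trace = a.2.trace)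
    (hs1 : ∀ w : Fin 2 → ℝ, w ≠ 0 → ∀ e, ∃ a ∈ A, a.1.mulVec w = e)
    (hs2 : ∀ w : Fin 2 → ℝ, w ≠ 0 → ∀ e, ∃ a ∈ A, a.2.mulVec w = e) :
    ∃ v w : Fin 2 → ℝ, v ≠ 0 ∧ w ≠ 0 ∧ ∀ a ∈ A, a.1.mulVec v = 0 → a.2.mulVec w = 0 := by
  by_cases h : ∃ a ∈ A, a.1 ≠ 0 ∧ a.1.det = 0
  · obtain ⟨a, ha, hne, hdet⟩ := h
    have hne2 : a.2 ≠ 0 := fun h => hne (fst_zero A hmul htr hs1 a ha h)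
    have key : ∀ B : Mat2, B ≠ 0 → ∃ u, B.mulVec u ≠ 0 := by
      intro B hB
      by_contra! h
      apply hB
      apply Matrix.mulVec_injective
      ext1 u
      simp [h u]
    obtain ⟨u, hu⟩ := key _ hne
    obtain ⟨u', hu'⟩ := key _ hne2
    refine ⟨_, _, hu, hu', fun b hb hbv => ?_⟩
    have h0 := mul_zero_of_singular _ _ hdet u hu hbv
    have h1 := snd_zero A hmul htr hs2 (b * a) (hmul _ hb _ ha) h0
    rw [Matrix.mulVec_mulVec]
    rw [Prod.snd_mul] at h1
    rw [h1, Matrix.zero_mulVec]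
  · push Not at h
    have hone : (fun _ : Fin 2 => (1 : ℝ)) ≠ 0 := fun h => one_ne_zero (congrFun h 0)
    refine ⟨fun _ => 1, fun _ => 1, hone, hone, fun a ha hav => ?_⟩
    have h0 : a.1 = 0 := by
      by_contra hne
      exact h a ha hne (Matrix.exists_mulVec_eq_zero_iff.mp ⟨_, hone, hav⟩)
    rw [snd_zero A hmul htr hs2 a ha h0, Matrix.zero_mulVec]

lemma exists_C (A : Submodule ℝ (Mat2 × Mat2))
    (hmul : ∀ a ∈ A, ∀ b ∈ A, a * b ∈ A)
    (htr : ∀ a ∈ A, a.1.trace = a.2.trace)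
    (hs1 : ∀ w : Fin 2 → ℝ, w ≠ 0 → ∀ e, ∃ a ∈ A, a.1.mulVec w = e)
    (hs2 : ∀ w : Fin 2 → ℝ, w ≠ 0 → ∀ e, ∃ a ∈ A, a.2.mulVec w = e) :
    ∃ C : Mat2, C.det ≠ 0 ∧ ∀ a ∈ A, C * a.1 = a.2 * C := by
  obtain ⟨v, w, hv, hw, hvw⟩ := exists_pair A hmul htr hs1 hs2
  have hex : ∀ e : Fin 2 → ℝ, ∃ e', ∃ a ∈ A, a.1.mulVec v = e ∧ a.2.mulVec w = e' := by
    intro e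
    obtain ⟨a, ha, h⟩ := hs1 v hv e
    exact ⟨_, a, ha, h, rfl⟩
  choose F hF using hex
  have hFa : ∀ a ∈ A, F (a.1.mulVec v) = a.2.mulVec w := by
    intro a ha
    obtain ⟨b, hb, h1, h2⟩ := hF (a.1.mulVec v)
    rw [← h2]
    have := hvw (b - a) (A.sub_mem hb ha) (by rw [Prod.fst_sub, Matrix.sub_mulVec, h1, sub_self])
    rw [Prod.snd_sub, Matrix.sub_mulVec] at this
    exact sub_eq_zero.mp this
  let L : (Fin 2 → ℝ) →ₗ[ℝ] (Fin 2 → ℝ) :=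
    { toFun := F
      map_add' := by
        intro x y
        obtain ⟨a, ha, rfl⟩ := hs1 v hv x
        obtain ⟨b, hb, rfl⟩ := hs1 v hv y
        rw [hFa a ha, hFa b hb, ← Matrix.add_mulVec, ← Matrix.add_mulVec]
        exact hFa (a + b) (A.add_mem ha hb)
      map_smul' := by
        intro c x
        obtain ⟨a, ha, rfl⟩ := hs1 v hv x
        rw [hFa a ha, ← Matrix.smul_mulVec, RingHom.id_apply, ← Matrix.smul_mulVec]
        exact hFa (c • a) (A.smul_mem c ha) }
  have hL : ∀ x, (LinearMap.toMatrix' L).mulVec x = F x := by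
    intro x
    rw [LinearMap.toMatrix'_mulVec]
    rfl
  refine ⟨LinearMap.toMatrix' L, ?_, ?_⟩
  · have hsurj : Function.Surjective (LinearMap.toMatrix' L).mulVec := by
      intro y
      obtain ⟨a, ha, rfl⟩ := hs2 w hw y
      exact ⟨a.1.mulVec v, by rw [hL, hFa a ha]⟩
    rw [Matrix.mulVec_surjective_iff_isUnit, Matrix.isUnit_iff_isUnit_det] at hsurj
    exact hsurj.ne_zero
  · intro a ha
    apply Matrix.mulVec_injective
    ext1 x
    obtain ⟨b, hb, rfl⟩ := hs1 v hv x
    rw [← Matrix.mulVec_mulVec, ← Matrix.mulVec_mulVec, hL, hL, hFa b hb, Matrix.mulVec_mulVec,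
      Matrix.mulVec_mulVec]
    exact hFa (a * b) (hmul _ ha _ hb)


/-- Two irreducible monoid representations into `SL^±(2,ℝ)` (i.e. into
`GL(2,ℝ)` with determinant `±1`) with equal traces are conjugate by a matrix of
determinant `±1`. -/
theorem stmt_0 (M : Type*) [Monoid M]
    (ρ η : M →* GL (Fin 2) ℝ)
    (hρdet : ∀ γ : M, ((ρ γ : Matrix (Fin 2) (Fin 2) ℝ)).det = 1 ∨
      ((ρ γ : Matrix (Fin 2) (Fin 2) ℝ)).det = -1)
    (hηdet : ∀ γ : M, ((η γ : Matrix (Fin 2) (Fin 2) ℝ)).det = 1 ∨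
      ((η γ : Matrix (Fin 2) (Fin 2) ℝ)).det = -1)
    (hρirr : ∀ V : Submodule ℝ (Fin 2 → ℝ),
      (∀ γ : M, ∀ v ∈ V, (ρ γ : Matrix (Fin 2) (Fin 2) ℝ).mulVec v ∈ V) → V = ⊥ ∨ V = ⊤)
    (hηirr : ∀ V : Submodule ℝ (Fin 2 → ℝ),
      (∀ γ : M, ∀ v ∈ V, (η γ : Matrix (Fin 2) (Fin 2) ℝ).mulVec v ∈ V) → V = ⊥ ∨ V = ⊤)
    (htr : ∀ γ : M, ((ρ γ : Matrix (Fin 2) (Fin 2) ℝ)).trace =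
      ((η γ : Matrix (Fin 2) (Fin 2) ℝ)).trace) :
    ∃ C : GL (Fin 2) ℝ,
      (((C : Matrix (Fin 2) (Fin 2) ℝ)).det = 1 ∨ ((C : Matrix (Fin 2) (Fin 2) ℝ)).det = -1) ∧
      ∀ γ : M, C * ρ γ * C⁻¹ = η γ := by

  classical
  let S : Set (Mat2 × Mat2) := Set.range fun γ : M => ((ρ γ : Mat2), (η γ : Mat2))
  let A : Submodule ℝ (Mat2 × Mat2) := Submodule.span ℝ S
  have hmem : ∀ γ : M, ((ρ γ : Mat2), (η γ : Mat2)) ∈ A := fun γ =>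
    Submodule.subset_span ⟨γ, rfl⟩
  have hone : (1 : Mat2 × Mat2) ∈ A := by
    have := hmem 1
    rw [map_one, map_one] at this
    exact this
  have hmul : ∀ a ∈ A, ∀ b ∈ A, a * b ∈ A := by
    intro a ha b hb
    have h := Submodule.mul_mem_mul ha hb
    rw [Submodule.span_mul_span] at h
    refine Submodule.span_mono ?_ h
    rintro _ ⟨_, ⟨γ, rfl⟩, _, ⟨δ, rfl⟩, rfl⟩
    exact ⟨γ * δ, by simp⟩
  have htrA : ∀ a ∈ A, a.1.trace = a.2.trace := by
    intro a ha
    induction ha using Submodule.span_induction with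
    | mem x hx => obtain ⟨γ, rfl⟩ := hx; exact htr γ
    | zero => simp
    | add x y _ _ hx hy => simp [Matrix.trace_add, hx, hy]
    | smul c x _ hx => simp [Matrix.trace_smul, hx]
  have hs1 : ∀ w : Fin 2 → ℝ, w ≠ 0 → ∀ e, ∃ a ∈ A, a.1.mulVec w = e := by
    intro w hw
    let V : Submodule ℝ (Fin 2 → ℝ) :=
      { carrier := {e | ∃ a ∈ A, a.1.mulVec w = e}
        zero_mem' := ⟨0, A.zero_mem, by simp⟩
        add_mem' := by
          rintro _ _ ⟨a, ha, rfl⟩ ⟨b, hb, rfl⟩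
          exact ⟨a + b, A.add_mem ha hb, Matrix.add_mulVec _ _ _⟩
        smul_mem' := by
          rintro c _ ⟨a, ha, rfl⟩
          exact ⟨c • a, A.smul_mem c ha, Matrix.smul_mulVec _ _ _⟩ }
    have hwV : w ∈ V := ⟨1, hone, by simp⟩
    rcases hρirr V (by
      rintro γ _ ⟨a, ha, rfl⟩
      exact ⟨_, hmul _ (hmem γ) _ ha, (Matrix.mulVec_mulVec _ _ _).symm⟩) with h | h
    · rw [h, Submodule.mem_bot] at hwV
      exact absurd hwV hw
    · intro e
      have : e ∈ V := h ▸ Submodule.mem_top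
      exact this
  have hs2 : ∀ w : Fin 2 → ℝ, w ≠ 0 → ∀ e, ∃ a ∈ A, a.2.mulVec w = e := by
    intro w hw
    let V : Submodule ℝ (Fin 2 → ℝ) :=
      { carrier := {e | ∃ a ∈ A, a.2.mulVec w = e}
        zero_mem' := ⟨0, A.zero_mem, by simp⟩
        add_mem' := by
          rintro _ _ ⟨a, ha, rfl⟩ ⟨b, hb, rfl⟩
          exact ⟨a + b, A.add_mem ha hb, Matrix.add_mulVec _ _ _⟩
        smul_mem' := by
          rintro c _ ⟨a, ha, rfl⟩
          exact ⟨c • a, A.smul_mem c ha, Matrix.smul_mulVec _ _ _⟩ }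
    have hwV : w ∈ V := ⟨1, hone, by simp⟩
    rcases hηirr V (by
      rintro γ _ ⟨a, ha, rfl⟩
      exact ⟨_, hmul _ (hmem γ) _ ha, (Matrix.mulVec_mulVec _ _ _).symm⟩) with h | h
    · rw [h, Submodule.mem_bot] at hwV
      exact absurd hwV hw
    · intro e
      have : e ∈ V := h ▸ Submodule.mem_top
      exact this
  obtain ⟨C, hC, hint⟩ := exists_C A hmul htrA hs1 hs2
  set s : ℝ := (Real.sqrt |C.det|)⁻¹ with hs
  have hspos : 0 < |C.det| := abs_pos.mpr hC
  have hdet : (s • C).det = C.det / |C.det| := by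
    rw [Matrix.det_smul, hs, Fintype.card_fin, inv_pow, Real.sq_sqrt hspos.le]
    field_simp
  have hdet' : (s • C).det = 1 ∨ (s • C).det = -1 := by
    rw [hdet]
    rcases abs_choice C.det with h | h
    · left; rw [h, div_self hC]
    · right; rw [h, div_neg, div_self hC]
  have hne : (s • C).det ≠ 0 := by
    rcases hdet' with h | h <;> rw [h] <;> norm_num
  refine ⟨Matrix.GeneralLinearGroup.mkOfDetNeZero (s • C) hne, hdet', fun γ => ?_⟩
  rw [mul_inv_eq_iff_eq_mul]
  apply Units.ext
  have := hint _ (hmem γ)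
  change (s • C) * (ρ γ : Mat2) = (η γ : Mat2) * (s • C)
  rw [Matrix.smul_mul, Matrix.mul_smul, this]
end

section
/- Let θ ∈ ℝ with sin θ ≠ 0 and cos θ ≠ 0, and let R = [[cos θ, −sin θ],[sin θ, cos θ]] be the corresponding rotation matrix. Let G be a subgroup of GL(2,ℝ) such that R⁻¹ g R ∈ G for every g ∈ G. If there exists a one-dimensional subspace V of ℝ² with g(V) = V for every g ∈ G, then every element of G is a real scalar multiple of the identity matrix. -/
/-- Let `R` be the rotation by an angle `θ` with `sin θ ≠ 0` and
`cos θ ≠ 0`.  If a subgroup `G ≤ GL(2,ℝ)` is invariant under conjugation by `R` and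
preserves some one-dimensional subspace `V ⊆ ℝ²`, then every element of `G` is a real
scalar multiple of the identity. -/
theorem stmt_4 (θ : ℝ) (hs : Real.sin θ ≠ 0) (hc : Real.cos θ ≠ 0)
    (R : GL (Fin 2) ℝ)
    (hR : (R : Matrix (Fin 2) (Fin 2) ℝ) =
      !![Real.cos θ, -Real.sin θ; Real.sin θ, Real.cos θ])
    (G : Subgroup (GL (Fin 2) ℝ))
    (hconj : ∀ g ∈ G, R⁻¹ * g * R ∈ G)
    (hV : ∃ V : Submodule ℝ (Fin 2 → ℝ), Module.finrank ℝ V = 1 ∧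
      ∀ g ∈ G, Submodule.map ((g : Matrix (Fin 2) (Fin 2) ℝ)).mulVecLin V = V) :
    ∀ g ∈ G, ∃ c : ℝ, (g : Matrix (Fin 2) (Fin 2) ℝ) = c • (1 : Matrix (Fin 2) (Fin 2) ℝ) := by
  obtain ⟨V, hV1, hinv⟩ := hV
  obtain ⟨⟨v, hvV⟩, hv0, hspan⟩ := finrank_eq_one_iff'.mp hV1
  have hvne : v ≠ 0 := fun h => hv0 (Subtype.ext h)
  have eig : ∀ g ∈ G, ∃ l : ℝ, (g : Matrix (Fin 2) (Fin 2) ℝ).mulVec v = l • v := by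
    intro g hg
    have h1 : (g : Matrix (Fin 2) (Fin 2) ℝ).mulVec v ∈ V := by
      have h2 := Submodule.mem_map_of_mem (f := (g : Matrix (Fin 2) (Fin 2) ℝ).mulVecLin) hvV
      rw [hinv g hg] at h2
      simpa using h2
    obtain ⟨l, hl⟩ := hspan ⟨_, h1⟩
    exact ⟨l, (congrArg Subtype.val hl).symm⟩
  have push : ∀ (g : GL (Fin 2) ℝ) (u : Fin 2 → ℝ) (m : ℝ),
      ((R⁻¹ * g * R : GL (Fin 2) ℝ) : Matrix (Fin 2) (Fin 2) ℝ).mulVec u = m • u →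
      (g : Matrix (Fin 2) (Fin 2) ℝ).mulVec ((R : Matrix (Fin 2) (Fin 2) ℝ).mulVec u)
        = m • (R : Matrix (Fin 2) (Fin 2) ℝ).mulVec u := by
    intro g u m h
    have h2 := congrArg ((R : Matrix (Fin 2) (Fin 2) ℝ).mulVec) h
    rw [Matrix.mulVec_mulVec, Matrix.mulVec_smul, ← Units.val_mul] at h2
    rw [Matrix.mulVec_mulVec, ← Units.val_mul, ← h2]
    congr 2
    group
  intro g hg
  obtain ⟨l, hl⟩ := eig g hg
  obtain ⟨m, hm⟩ := eig _ (hconj g hg)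
  obtain ⟨n, hn⟩ := eig _ (hconj _ (hconj g hg))
  replace hm := push _ _ _ hm
  replace hn := push _ _ _ (push _ _ _ hn)
  rw [hR] at hm hn
  have hpos : v 0 ^ 2 + v 1 ^ 2 ≠ 0 := by
    intro h
    apply hvne
    have h0 : v 0 = 0 := by nlinarith [sq_nonneg (v 0), sq_nonneg (v 1)]
    have h1 : v 1 = 0 := by nlinarith [sq_nonneg (v 0), sq_nonneg (v 1)]
    ext i
    fin_cases i
    · exact h0
    · exact h1
  have hcs := Real.sin_sq_add_cos_sq θ
  generalize Real.sin θ = s at *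
  generalize Real.cos θ = c at *
  have l0 := congrFun hl 0
  have l1 := congrFun hl 1
  have m0 := congrFun hm 0
  have m1 := congrFun hm 1
  have n0 := congrFun hn 0
  have n1 := congrFun hn 1
  simp only [Matrix.mulVec, dotProduct, Fin.sum_univ_two, Pi.smul_apply, smul_eq_mul,
    Matrix.of_apply, Matrix.cons_val_zero, Matrix.cons_val_one, Matrix.cons_val',
    Matrix.cons_val_fin_one] at l0 l1 m0 m1 n0 n1
  generalize v 0 = x at *
  generalize v 1 = y at *
  have hD : s * (x ^ 2 + y ^ 2) ≠ 0 := mul_ne_zero hs hpos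
  have e0 : 2 * c * (m - n) * (c * x - s * y) = (l - n) * x := by
    have hss : s ^ 2 = 1 - c ^ 2 := by linarith
    grind
  have e1 : 2 * c * (m - n) * (s * x + c * y) = (l - n) * y := by
    have hss : s ^ 2 = 1 - c ^ 2 := by linarith
    grind
  have hmn : m = n := by
    have : (2 * c * (s * (x ^ 2 + y ^ 2))) * (m - n) = 0 := by
      linear_combination x * e1 - y * e0
    have h2 : (2 * c * (s * (x ^ 2 + y ^ 2))) ≠ 0 := mul_ne_zero (mul_ne_zero two_ne_zero hc) hD
    linarith [(mul_eq_zero.mp this).resolve_left h2]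
  have hln : l = n := by
    subst hmn
    have : (x ^ 2 + y ^ 2) * (l - m) = 0 := by linear_combination -x * e0 - y * e1
    linarith [(mul_eq_zero.mp this).resolve_left hpos]
  have hml : m = l := hmn.trans hln.symm
  subst hml
  have key : ∀ a b : ℝ, a * x + b * y = 0 → a * (c * x - s * y) + b * (s * x + c * y) = 0 →
      a = 0 ∧ b = 0 := by
    intro a b h1 h2
    have h3 : s * (b * x - a * y) = 0 := by linear_combination h2 - c * h1
    have h4 := (mul_eq_zero.mp h3).resolve_left hs
    constructor
    · have : (x ^ 2 + y ^ 2) * a = 0 := by linear_combination x * h1 - y * h4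
      exact (mul_eq_zero.mp this).resolve_left hpos
    · have : (x ^ 2 + y ^ 2) * b = 0 := by linear_combination y * h1 + x * h4
      exact (mul_eq_zero.mp this).resolve_left hpos
  obtain ⟨a1, a2⟩ := key ((g : Matrix (Fin 2) (Fin 2) ℝ) 0 0 - m)
    ((g : Matrix (Fin 2) (Fin 2) ℝ) 0 1) (by linear_combination l0) (by linear_combination m0)
  obtain ⟨b1, b2⟩ := key ((g : Matrix (Fin 2) (Fin 2) ℝ) 1 0)
    ((g : Matrix (Fin 2) (Fin 2) ℝ) 1 1 - m) (by linear_combination l1) (by linear_combination m1)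
  refine ⟨m, ?_⟩
  ext i j
  fin_cases i <;> fin_cases j <;> simp <;> linarith
end
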